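/- arXiv:2603.25822 — 2 statements merged into one kernel-verified Lean document; each statement's English description precedes it below -/
import Mathlib

section
/- Let f : ℝⁿ → ℝ be twice continuously differentiable, proper (coercive), bounded below, attaining its minimum f* at a unique global minimizer x*, with vᵀ ∇²f(x*) v ≥ ν ‖v‖₂² for all v (for some ν > 0), and suppose f satisfies a strong-PLI: there is a continuous, strictly increasing function α : [0,∞) → [0,∞) with α(0) = 0 and α(r) → ∞ as r → ∞ such that ‖∇f(x)‖₂ ≥ α(f(x) − f*) for all x ∈ ℝⁿ, and additionally ∫_{s₀}^{∞} α(s − f*)^{−2} ds < ∞ for every s₀ > f*. Assume further that f is m-magnitude-bounded concave for some m > 0, i.e., λ_min(∇²f(x)) > −m for all x ∈ ℝⁿ. Then the gradient flow ẋ = −∇f(x) is globally incrementally exponentially stable: there exist c > 0 and κ > 0 such that any two solutions x(·), y(·) satisfy ‖x(t) − y(t)‖₂ ≤ c e^{−κ t} ‖x(0) − y(0)‖₂ for all t ≥ 0; in particular, x* is globally exponentially stable. -/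
open scoped RealInnerProductSpace

section GradientFlow

variable {E : Type*} [NormedAddCommGroup E] [InnerProductSpace ℝ E]

/-- On a convex set where the derivative of `g` is bounded below by `k` as a quadratic form, `g` is
`k`-monotone. -/
lemma mul_norm_sub_sq_le_inner_of_le_inner_fderiv {g : E → E} (hg : Differentiable ℝ g) {S : Set E}
    (hS : Convex ℝ S) {k : ℝ} (hk : ∀ z ∈ S, ∀ v, k * ‖v‖ ^ 2 ≤ ⟪fderiv ℝ g z v, v⟫)
    {x y : E} (hx : x ∈ S) (hy : y ∈ S) :
    k * ‖x - y‖ ^ 2 ≤ ⟪g x - g y, x - y⟫ := by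
  have hd : ∀ t : ℝ, HasDerivAt (fun t : ℝ => ⟪g (y + t • (x - y)), x - y⟫)
      ⟪fderiv ℝ g (y + t • (x - y)) (x - y), x - y⟫ t := by
    intro t
    have h1 : HasDerivAt (fun t : ℝ => y + t • (x - y)) (x - y) t := by
      simpa using ((hasDerivAt_id t).smul_const (x - y)).const_add y
    have h2 := (hg (y + t • (x - y))).hasFDerivAt.comp_hasDerivAt t h1
    simpa using h2.inner ℝ (hasDerivAt_const t (x - y))
  obtain ⟨c, hc, hc'⟩ := exists_hasDerivAt_eq_slope _ _ (zero_lt_one (α := ℝ))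
    (fun t _ => (hd t).continuousAt.continuousWithinAt) (fun t _ => hd t)
  have hmem : y + c • (x - y) ∈ S := hS.add_smul_sub_mem hy hx ⟨hc.1.le, hc.2.le⟩
  have h3 := hk _ hmem (x - y)
  rw [hc'] at h3
  simpa [inner_sub_left] using h3

/-- Two solutions of `ẋ = -g x` contract at rate `k` as long as `g` is `k`-monotone along them. -/
lemma norm_sub_le_exp_mul_of_mul_norm_sub_sq_le_inner {g : E → E} {x y : ℝ → E} {k s t : ℝ}
    (hst : s ≤ t)
    (hx : ∀ u, s ≤ u → HasDerivAt x (-(g (x u))) u)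
    (hy : ∀ u, s ≤ u → HasDerivAt y (-(g (y u))) u)
    (hk : ∀ u, s ≤ u → k * ‖x u - y u‖ ^ 2 ≤ ⟪g (x u) - g (y u), x u - y u⟫) :
    ‖x t - y t‖ ≤ Real.exp (-k * (t - s)) * ‖x s - y s‖ := by
  have hd : ∀ u, s ≤ u → HasDerivAt (fun u => Real.exp (2 * k * u) * ‖x u - y u‖ ^ 2)
      (Real.exp (2 * k * u) * (2 * k) * ‖x u - y u‖ ^ 2 +
        Real.exp (2 * k * u) * (2 * ⟪x u - y u, -(g (x u)) - -(g (y u))⟫)) u := by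
    intro u hu
    have h1 : HasDerivAt (fun u => Real.exp (2 * k * u)) (Real.exp (2 * k * u) * (2 * k)) u := by
      simpa using ((hasDerivAt_id u).const_mul (2 * k)).exp
    exact h1.mul ((hx u hu).sub (hy u hu)).norm_sq
  have hanti : AntitoneOn (fun u => Real.exp (2 * k * u) * ‖x u - y u‖ ^ 2) (Set.Ici s) := by
    refine antitoneOn_of_hasDerivWithinAt_nonpos (convex_Ici s)
      (fun u hu => (hd u hu).continuousAt.continuousWithinAt)
      (fun u hu => (hd u (interior_subset hu)).hasDerivWithinAt) (fun u hu => ?_)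
    have h2 := hk u (interior_subset hu)
    have h3 : ⟪x u - y u, -(g (x u)) - -(g (y u))⟫ = -⟪g (x u) - g (y u), x u - y u⟫ := by
      rw [real_inner_comm, ← inner_neg_left]
      congr 1
      abel
    rw [h3]
    have h4 := Real.exp_pos (2 * k * u)
    nlinarith
  have h5 : Real.exp (2 * k * t) * ‖x t - y t‖ ^ 2 ≤ Real.exp (2 * k * s) * ‖x s - y s‖ ^ 2 :=
    hanti (Set.mem_Ici.2 le_rfl) (Set.mem_Ici.2 hst) hst
  refine le_of_sq_le_sq ?_ (by positivity)
  have h6 : Real.exp (-(2 * k * t)) * Real.exp (2 * k * t) = 1 := by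
    rw [← Real.exp_add]; simp
  calc ‖x t - y t‖ ^ 2
      = Real.exp (-(2 * k * t)) * (Real.exp (2 * k * t) * ‖x t - y t‖ ^ 2) := by
        rw [← mul_assoc, h6, one_mul]
    _ ≤ Real.exp (-(2 * k * t)) * (Real.exp (2 * k * s) * ‖x s - y s‖ ^ 2) := by gcongr
    _ = (Real.exp (-k * (t - s)) * ‖x s - y s‖) ^ 2 := by
        rw [mul_pow, ← Real.exp_nat_mul, ← mul_assoc, ← Real.exp_add]
        congr 2
        push_cast
        ring

/-- Small sublevel sets of a coercive continuous function with a unique global minimizer lie in any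
given ball around the minimizer. -/
lemma exists_sublevel_subset_ball {X : Type*} [PseudoMetricSpace X] {f : X → ℝ}
    (hf : Continuous f) (hcoercive : Filter.Tendsto f (Filter.cocompact X) Filter.atTop)
    {z₀ : X} (hmin : ∀ x, f z₀ ≤ f x) (huniq : ∀ x, (∀ y, f x ≤ f y) → x = z₀)
    {r : ℝ} (hr : 0 < r) :
    ∃ δ > 0, ∀ z, f z ≤ f z₀ + δ → z ∈ Metric.ball z₀ r := by
  obtain ⟨K, hK, hKf⟩ := Filter.mem_cocompact.1 (hcoercive.eventually_ge_atTop (f z₀ + 1))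
  have hout : ∀ z, z ∉ K → f z₀ + 1 ≤ f z := fun z hz => hKf hz
  rcases (K \ Metric.ball z₀ r).eq_empty_or_nonempty with h | h
  · refine ⟨1 / 2, by norm_num, fun z hz => ?_⟩
    have hzK : z ∈ K := by
      by_contra hzK
      linarith [hout z hzK]
    exact Set.sdiff_eq_empty.1 h hzK
  · obtain ⟨w, hw, hwmin⟩ := (hK.diff Metric.isOpen_ball).exists_isMinOn h hf.continuousOn
    have hlt : f z₀ < f w := by
      refine lt_of_le_of_ne (hmin w) fun heq => hw.2 ?_
      rw [huniq w fun y => heq ▸ hmin y]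
      exact Metric.mem_ball_self hr
    refine ⟨min (1 / 2) ((f w - f z₀) / 2), lt_min (by norm_num) (by linarith), fun z hz => ?_⟩
    by_contra hzr
    have hzK : z ∈ K := by
      by_contra hzK
      linarith [hout z hzK, min_le_left (1 / 2) ((f w - f z₀) / 2)]
    have h1 : f w ≤ f z := hwmin ⟨hzK, hzr⟩
    linarith [min_le_right (1 / 2) ((f w - f z₀) / 2)]

/-- If `φ' ≤ -b φ` with `b` positive above level `s₁` and `1 / b` integrable there, then `φ` drops
to the level `s₁` within a time that does not depend on the initial value of `φ`. -/
lemma le_of_integral_inv_lt {φ φ' b : ℝ → ℝ} {s₁ T : ℝ}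
    (hT : ∫ s in Set.Ici s₁, (b s)⁻¹ < T)
    (hb : ContinuousOn b (Set.Ici s₁)) (hpos : ∀ s, s₁ ≤ s → 0 < b s)
    (hint : MeasureTheory.IntegrableOn (fun s => (b s)⁻¹) (Set.Ici s₁))
    (hφ : ∀ t, 0 ≤ t → HasDerivAt φ (φ' t) t) (hle : ∀ t, 0 ≤ t → φ' t ≤ -b (φ t)) :
    ∃ t ∈ Set.Icc 0 T, φ t ≤ s₁ := by
  have hnn : 0 ≤ ∫ s in Set.Ici s₁, (b s)⁻¹ :=
    MeasureTheory.setIntegral_nonneg measurableSet_Ici fun s hs => (inv_pos.2 (hpos s hs)).le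
  by_contra! hgt
  have hii : ∀ u, s₁ ≤ u → IntervalIntegrable (fun s => (b s)⁻¹) MeasureTheory.volume s₁ u :=
    fun u hu => (intervalIntegrable_iff_integrableOn_Icc_of_le hu).2
      (hint.mono_set Set.Icc_subset_Ici_self)
  have hw : ∀ u, s₁ < u → HasDerivAt (fun u => ∫ s in s₁..u, (b s)⁻¹) (b u)⁻¹ u := by
    intro u hu
    have hci : ContinuousOn (fun s => (b s)⁻¹) (Set.Ioi s₁) :=
      (hb.mono Set.Ioi_subset_Ici_self).inv₀ fun s hs => (hpos s (le_of_lt hs)).ne'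
    exact intervalIntegral.integral_hasDerivAt_right (hii u hu.le)
      (hci.stronglyMeasurableAtFilter isOpen_Ioi u hu)
      (hci.continuousAt (Ioi_mem_nhds hu))
  have hd : ∀ t ∈ Set.Icc 0 T,
      HasDerivAt (fun t => (∫ s in s₁..φ t, (b s)⁻¹) + t) ((b (φ t))⁻¹ * φ' t + 1) t :=
    fun t ht => ((hw _ (hgt t ht)).comp t (hφ t ht.1)).add (hasDerivAt_id t)
  have hanti : AntitoneOn (fun t => (∫ s in s₁..φ t, (b s)⁻¹) + t) (Set.Icc 0 T) := by
    refine antitoneOn_of_hasDerivWithinAt_nonpos (convex_Icc 0 T)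
      (fun t ht => (hd t ht).continuousAt.continuousWithinAt)
      (fun t ht => (hd t (interior_subset ht)).hasDerivWithinAt) (fun t ht => ?_)
    have ht' := interior_subset ht
    have h1 := hpos _ (hgt t ht').le
    have h2 := mul_le_mul_of_nonneg_left (hle t ht'.1) (inv_pos.2 h1).le
    rw [mul_neg, inv_mul_cancel₀ h1.ne'] at h2
    linarith
  have hT0 : 0 ≤ T := hnn.trans hT.le
  have h0 : (0 : ℝ) ∈ Set.Icc 0 T := ⟨le_rfl, hT0⟩
  have hTT : T ∈ Set.Icc 0 T := ⟨hT0, le_rfl⟩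
  have h3 : (∫ s in s₁..φ T, (b s)⁻¹) + T ≤ (∫ s in s₁..φ 0, (b s)⁻¹) + 0 := hanti h0 hTT hT0
  have h4 : 0 ≤ ∫ s in s₁..φ T, (b s)⁻¹ :=
    intervalIntegral.integral_nonneg (hgt T hTT).le fun s hs => (inv_pos.2 (hpos s hs.1)).le
  have h5 : ∫ s in s₁..φ 0, (b s)⁻¹ ≤ ∫ s in Set.Ici s₁, (b s)⁻¹ := by
    rw [intervalIntegral.integral_of_le (hgt 0 h0).le]
    refine MeasureTheory.setIntegral_mono_set hint ?_
      (Set.Ioc_subset_Ioi_self.trans Set.Ioi_subset_Ici_self).eventuallyLE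
    filter_upwards [MeasureTheory.ae_restrict_mem measurableSet_Ici] with s hs
    exact (inv_pos.2 (hpos s hs)).le
  linarith

/-- A `C²` function has a `C¹` gradient. -/
lemma ContDiff.gradient_of_two [CompleteSpace E] {f : E → ℝ} (hf : ContDiff ℝ 2 f) :
    ContDiff ℝ 1 (gradient f) :=
  (InnerProductSpace.toDual ℝ E).symm.contDiff.comp (hf.fderiv_right (by norm_num))

/-- Along the gradient flow, `f` decreases at rate `‖∇f‖²`. -/
lemma hasDerivAt_comp_gradient_flow [CompleteSpace E] {f : E → ℝ} (hf : Differentiable ℝ f)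
    {x : ℝ → E} {t : ℝ} (hx : HasDerivAt x (-(gradient f (x t))) t) :
    HasDerivAt (fun t => f (x t)) (-‖gradient f (x t)‖ ^ 2) t := by
  have h := (hf (x t)).hasGradientAt.hasFDerivAt.comp_hasDerivAt t hx
  rw [InnerProductSpace.toDual_apply_apply, inner_neg_right, real_inner_self_eq_norm_sq] at h
  exact h

/-- A `C¹` vector field whose derivative is bounded below by `ν` at a point is `ν / 2`-monotone on
a ball around that point. -/
lemma exists_ball_half_monotone {g : E → E} (hg : ContDiff ℝ 1 g) {z₀ : E} {ν : ℝ} (hν : 0 < ν)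
    (hconv : ∀ v, ν * ‖v‖ ^ 2 ≤ ⟪fderiv ℝ g z₀ v, v⟫) :
    ∃ r > 0, ∀ x ∈ Metric.ball z₀ r, ∀ y ∈ Metric.ball z₀ r,
      ν / 2 * ‖x - y‖ ^ 2 ≤ ⟪g x - g y, x - y⟫ := by
  obtain ⟨r, hr, hball⟩ := Metric.continuousAt_iff.1
    ((hg.continuous_fderiv (by norm_num)).continuousAt (x := z₀)) (ν / 2) (by positivity)
  refine ⟨r, hr, fun x hx y hy => mul_norm_sub_sq_le_inner_of_le_inner_fderiv
    (hg.differentiable (by norm_num)) (convex_ball z₀ r) (fun z hz v => ?_) hx hy⟩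
  have h1 : ‖fderiv ℝ g z - fderiv ℝ g z₀‖ < ν / 2 := by
    rw [← dist_eq_norm]; exact hball hz
  have h2 : -(ν / 2 * ‖v‖ ^ 2) ≤ ⟪(fderiv ℝ g z - fderiv ℝ g z₀) v, v⟫ := by
    refine (abs_le.1 ((abs_real_inner_le_norm _ _).trans ?_)).1
    calc ‖(fderiv ℝ g z - fderiv ℝ g z₀) v‖ * ‖v‖
        ≤ ν / 2 * ‖v‖ * ‖v‖ := by
          gcongr
          exact ((fderiv ℝ g z - fderiv ℝ g z₀).le_opNorm v).trans (by gcongr)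
      _ = ν / 2 * ‖v‖ ^ 2 := by ring
  rw [sub_apply, inner_sub_left] at h2
  linarith [hconv v]

end GradientFlow

/-- Theorem 3 (global IES under a strong-PLI and magnitude-bounded concavity).
Let `f : ℝⁿ → ℝ` be `C²`, coercive, bounded below, with a unique global minimizer `x*` where
`vᵀ ∇²f(x*) v ≥ ν ‖v‖₂²` (`ν > 0`), satisfying a strong-PLI: a `𝒦∞`-PLI
`‖∇f(x)‖ ≥ α(f(x) - f*)` with `∫_{s₀}^∞ α(s - f*)⁻² ds < ∞` for every `s₀ > f*`. If moreover
`f` is `m`-magnitude-bounded concave for some `m > 0`, i.e. `λ_min(∇²f(x)) > -m` for all `x`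
(expressed via the quadratic form on unit vectors), then the gradient flow `ẋ = -∇f(x)` is
globally incrementally exponentially stable; in particular `x*` is globally exponentially
stable. -/
theorem global_ies_magnitude_bounded_concave {n : ℕ}
    (f : EuclideanSpace ℝ (Fin n) → ℝ)
    (hf : ContDiff ℝ 2 f)
    (hcoercive : Filter.Tendsto f (Filter.cocompact (EuclideanSpace ℝ (Fin n))) Filter.atTop)
    (hbdd : BddBelow (Set.range f))
    (xstar : EuclideanSpace ℝ (Fin n))
    (hmin : ∀ x, f xstar ≤ f x)
    (huniq : ∀ x, (∀ y, f x ≤ f y) → x = xstar)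
    (ν : ℝ) (hν : 0 < ν)
    (hconv : ∀ v, ν * ‖v‖ ^ 2 ≤ ⟪fderiv ℝ (gradient f) xstar v, v⟫)
    (a : ℝ → ℝ)
    (ha_cont : ContinuousOn a (Set.Ici 0))
    (ha_mono : StrictMonoOn a (Set.Ici 0))
    (ha_zero : a 0 = 0)
    (ha_nonneg : ∀ r, 0 ≤ r → 0 ≤ a r)
    (ha_top : Filter.Tendsto a Filter.atTop Filter.atTop)
    (hPLI : ∀ x, a (f x - f xstar) ≤ ‖gradient f x‖)
    (ha_int : ∀ s₀ > f xstar,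
      MeasureTheory.IntegrableOn (fun s => (a (s - f xstar) ^ 2)⁻¹) (Set.Ici s₀))
    (m : ℝ) (hm : 0 < m)
    (hmb : ∀ x v, ‖v‖ = 1 → -m < ⟪fderiv ℝ (gradient f) x v, v⟫) :
    ∃ c > (0:ℝ), ∃ κ > (0:ℝ),
      (∀ x y : ℝ → EuclideanSpace ℝ (Fin n),
        (∀ t, 0 ≤ t → HasDerivAt x (-(gradient f (x t))) t) →
        (∀ t, 0 ≤ t → HasDerivAt y (-(gradient f (y t))) t) →
        ∀ t, 0 ≤ t →
          ‖x t - y t‖ ≤ c * Real.exp (-κ * t) * ‖x 0 - y 0‖) ∧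
      (∀ x : ℝ → EuclideanSpace ℝ (Fin n),
        (∀ t, 0 ≤ t → HasDerivAt x (-(gradient f (x t))) t) →
        ∀ t, 0 ≤ t →
          ‖x t - xstar‖ ≤ c * Real.exp (-κ * t) * ‖x 0 - xstar‖) := by
  have hg := hf.gradient_of_two
  have hfd : Differentiable ℝ f := hf.differentiable (by norm_num)
  obtain ⟨r, hr, hloc⟩ := exists_ball_half_monotone hg hν hconv
  obtain ⟨δ, hδ, hsub⟩ := exists_sublevel_subset_ball hf.continuous hcoercive hmin huniq hr
  have hglob : ∀ x y, -m * ‖x - y‖ ^ 2 ≤ ⟪gradient f x - gradient f y, x - y⟫ := by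
    refine fun x y => mul_norm_sub_sq_le_inner_of_le_inner_fderiv
      (hg.differentiable (by norm_num)) convex_univ (fun z _ v => ?_)
      (Set.mem_univ x) (Set.mem_univ y)
    rcases eq_or_ne v 0 with rfl | hv
    · simp
    · have hv' : 0 < ‖v‖ := norm_pos_iff.2 hv
      have h1 := hmb z (‖v‖⁻¹ • v) (by
        rw [norm_smul, norm_inv, norm_norm, inv_mul_cancel₀ hv'.ne'])
      rw [map_smul, real_inner_smul_left, real_inner_smul_right, ← mul_assoc, ← mul_inv,
        ← sq, inv_mul_eq_div, lt_div_iff₀ (by positivity)] at h1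
      exact h1.le
  obtain ⟨T, hT⟩ := exists_gt (∫ s in Set.Ici (f xstar + δ), (a (s - f xstar) ^ 2)⁻¹)
  have hT0 : 0 ≤ T := (MeasureTheory.integral_nonneg fun s => by positivity).trans hT.le
  have hpos : ∀ s, f xstar + δ ≤ s → 0 < a (s - f xstar) := by
    intro s hs
    rw [← ha_zero]
    exact ha_mono (Set.mem_Ici.2 le_rfl) (Set.mem_Ici.2 (by linarith)) (by linarith)
  have hreach : ∀ x : ℝ → EuclideanSpace ℝ (Fin n),
      (∀ t, 0 ≤ t → HasDerivAt x (-(gradient f (x t))) t) →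
      ∀ t, T ≤ t → x t ∈ Metric.ball xstar r := by
    intro x hx t ht
    have hφ := fun u hu => hasDerivAt_comp_gradient_flow hfd (hx u hu)
    have hanti : AntitoneOn (fun u => f (x u)) (Set.Ici 0) :=
      antitoneOn_of_hasDerivWithinAt_nonpos (convex_Ici 0)
        (fun u hu => (hφ u hu).continuousAt.continuousWithinAt)
        (fun u hu => (hφ u (interior_subset hu)).hasDerivWithinAt)
        (fun u _ => neg_nonpos.2 (sq_nonneg _))
    obtain ⟨u, hu, hfu⟩ := le_of_integral_inv_lt (b := fun s => a (s - f xstar) ^ 2) hT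
      ((ha_cont.comp (by fun_prop) fun s hs => by
        simp only [Set.mem_Ici] at hs ⊢; linarith).pow 2)
      (fun s hs => pow_pos (hpos s hs) 2) (ha_int _ (by linarith)) hφ
      (fun u _ => neg_le_neg (pow_le_pow_left₀
        (ha_nonneg _ (sub_nonneg.2 (hmin _))) (hPLI (x u)) 2))
    exact hsub _ ((hanti hu.1 (hT0.trans ht) (hu.2.trans ht)).trans hfu)
  have hIES : ∀ x y : ℝ → EuclideanSpace ℝ (Fin n),
      (∀ t, 0 ≤ t → HasDerivAt x (-(gradient f (x t))) t) →
      (∀ t, 0 ≤ t → HasDerivAt y (-(gradient f (y t))) t) →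
      ∀ t, 0 ≤ t → ‖x t - y t‖ ≤
        Real.exp ((m + ν / 2) * T) * Real.exp (-(ν / 2) * t) * ‖x 0 - y 0‖ := by
    intro x y hx hy t ht
    have hgrow : ∀ u, 0 ≤ u → ‖x u - y u‖ ≤ Real.exp (m * u) * ‖x 0 - y 0‖ := fun u hu => by
      simpa using norm_sub_le_exp_mul_of_mul_norm_sub_sq_le_inner hu hx hy
        (fun _ _ => hglob _ _)
    rw [← Real.exp_add]
    rcases le_total t T with htT | hTt
    · refine (hgrow t ht).trans ?_
      gcongr
      nlinarith
    · calc ‖x t - y t‖ ≤ Real.exp (-(ν / 2) * (t - T)) * ‖x T - y T‖ :=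
            norm_sub_le_exp_mul_of_mul_norm_sub_sq_le_inner hTt
              (fun u hu => hx u (hT0.trans hu)) (fun u hu => hy u (hT0.trans hu))
              (fun u hu => hloc _ (hreach x hx u hu) _ (hreach y hy u hu))
        _ ≤ Real.exp (-(ν / 2) * (t - T)) * (Real.exp (m * T) * ‖x 0 - y 0‖) := by
            gcongr
            exact hgrow T hT0
        _ = Real.exp ((m + ν / 2) * T + -(ν / 2) * t) * ‖x 0 - y 0‖ := by
            rw [← mul_assoc, ← Real.exp_add]
            congr 2
            ring
  have hcrit : gradient f xstar = 0 := by
    rw [gradient, IsLocalMin.fderiv_eq_zero (Filter.Eventually.of_forall hmin), map_zero]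
  refine ⟨_, Real.exp_pos _, ν / 2, by positivity, hIES, fun x hx => ?_⟩
  refine hIES x (fun _ => xstar) hx fun t _ => ?_
  simpa [hcrit] using hasDerivAt_const t xstar
end

section
/- Define f : ℝ → ℝ by f(x) = x·log(x + √(1 + x²)) − √(1 + x²) + 1. Then for every p > 0, lim_{x→∞} (log(x + √(1 + x²)))^p / f(x) = 0. Consequently, for no p > 0 and c > 0 does the inequality |f'(x)|^p ≥ c·f(x) hold for all x ∈ ℝ; i.e., f satisfies no Łojasiewicz inequality with comparison function of the power form α(s) = (c s)^{1/p}. -/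
open Real Filter Topology in
theorem tendsto_arsinh_atTop : Tendsto arsinh atTop atTop :=
  arsinh_strictMono.monotone.tendsto_atTop_atTop fun b => ⟨sinh b, (arsinh_sinh b).ge⟩

open Real in
theorem hasDerivAt_mul_arsinh_sub_sqrt (x : ℝ) :
    HasDerivAt (fun y => y * arsinh y - √(1 + y ^ 2) + 1) (arsinh x) x := by
  have hpos : 0 < 1 + x ^ 2 := by positivity
  have hsqrt : HasDerivAt (fun y : ℝ => √(1 + y ^ 2)) (2 * x / (2 * √(1 + x ^ 2))) x := by
    simpa using ((hasDerivAt_pow 2 x).const_add 1).sqrt hpos.ne'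
  refine ((((hasDerivAt_id x).mul (hasDerivAt_arsinh x)).sub hsqrt).add_const 1).congr_deriv ?_
  have := (sqrt_pos.2 hpos).ne'
  simp only [id]
  field_simp
  ring

open Real in
theorem exp_arsinh_div_four_le {x : ℝ} (hx : 2 ≤ arsinh x) :
    exp (arsinh x) / 4 ≤ x * arsinh x - √(1 + x ^ 2) + 1 := by
  have hx0 : 0 ≤ x := arsinh_nonneg_iff.1 (by linarith)
  have hsqrt : √(1 + x ^ 2) ≤ 1 + x := sqrt_le_iff.2 ⟨by linarith, by nlinarith⟩
  have hexp := exp_arsinh x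
  have hlarge := add_one_le_exp (arsinh x)
  nlinarith

open Real Filter Topology in
theorem tendsto_arsinh_rpow_div_atTop (p : ℝ) :
    Tendsto (fun x => arsinh x ^ p / (x * arsinh x - √(1 + x ^ 2) + 1)) atTop (𝓝 0) := by
  have hlim : Tendsto (fun x => 4 * (arsinh x ^ p * exp (-1 * arsinh x))) atTop (𝓝 0) := by
    simpa using ((tendsto_rpow_mul_exp_neg_mul_atTop_nhds_zero p 1 one_pos).comp
      tendsto_arsinh_atTop).const_mul 4
  have hlarge := tendsto_arsinh_atTop.eventually_ge_atTop 2
  refine squeeze_zero' ?_ ?_ hlim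
  · filter_upwards [hlarge] with x hx
    have hf := exp_arsinh_div_four_le hx
    have := exp_pos (arsinh x)
    exact div_nonneg (rpow_nonneg (by linarith) p) (by linarith)
  · filter_upwards [hlarge] with x hx
    have hpow : 0 ≤ arsinh x ^ p := rpow_nonneg (by linarith) p
    calc arsinh x ^ p / (x * arsinh x - √(1 + x ^ 2) + 1)
        ≤ arsinh x ^ p / (exp (arsinh x) / 4) :=
          div_le_div_of_nonneg_left hpow (by positivity) (exp_arsinh_div_four_le hx)
      _ = 4 * (arsinh x ^ p * exp (-1 * arsinh x)) := by
          rw [neg_one_mul, exp_neg]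
          field_simp

/-- For `f(x) = x log(x + √(1+x²)) - √(1+x²) + 1`: for every `p > 0`,
`(log(x + √(1+x²)))^p / f(x) → 0` as `x → ∞`; consequently, for no `p > 0` and `c > 0`
does `|f'(x)|^p ≥ c f(x)` hold for all `x`, i.e. `f` satisfies no Łojasiewicz inequality
with comparison function of the power form `α(s) = (c s)^{1/p}` (note `f* = f(0) = 0`). -/
theorem example_function_no_power_lojasiewicz
    (f : ℝ → ℝ)
    (hf : ∀ x, f x = x * Real.log (x + Real.sqrt (1 + x ^ 2))
      - Real.sqrt (1 + x ^ 2) + 1) :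
    (∀ p : ℝ, 0 < p →
      Filter.Tendsto
        (fun x : ℝ => (Real.log (x + Real.sqrt (1 + x ^ 2))) ^ p / f x)
        Filter.atTop (nhds 0)) ∧
    (∀ p : ℝ, 0 < p → ∀ c : ℝ, 0 < c →
      ¬ (∀ x : ℝ, c * f x ≤ |deriv f x| ^ p)) := by
  obtain rfl : f = fun x => x * Real.arsinh x - Real.sqrt (1 + x ^ 2) + 1 := funext hf
  refine ⟨fun p _ => tendsto_arsinh_rpow_div_atTop p, fun p _ c hc h => ?_⟩
  obtain ⟨x, hlt, hx⟩ := (((tendsto_arsinh_rpow_div_atTop p).eventually_lt_const hc).and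
    (tendsto_arsinh_atTop.eventually_ge_atTop 2)).exists
  have hf_pos := (div_pos (Real.exp_pos (Real.arsinh x)) four_pos).trans_le
    (exp_arsinh_div_four_le hx)
  have hle := h x
  rw [(hasDerivAt_mul_arsinh_sub_sqrt x).deriv, abs_of_nonneg (by linarith)] at hle
  exact hle.not_gt ((div_lt_iff₀ hf_pos).1 hlt)
end
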